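/- The insertion of permutations satisfies the parallel composition axiom: for permutations λ of {1,…,m}, μ of {1,…,n}, ν of {1,…,k}, and indices 1 ≤ i < j ≤ m, one has (λ ∘_j μ) ∘_i ν = (λ ∘_i ν) ∘_{j+k−1} μ as permutations of {1,…,m+n+k−2}. -/

import Mathlib

/-- The insertion `σ ∘ᵢ τ` of a permutation `τ` of `{1,…,k}` into a permutation `σ`
(of `{1,…,n}`) at place `i`:  on the block `i ≤ x ≤ i + k - 1` it is given by
`τ (x - i + 1) + σ i - 1`, and outside this block it is `f (σ x')` where `x' = x`
for `x < i`, `x' = x - k + 1` for `x > i + k - 1`, and `f v = v` for `v ≤ σ i`,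
`f v = v + k - 1` for `v > σ i`. -/
def insertPerm (k i : ℕ) (σ τ : ℕ → ℕ) : ℕ → ℕ := fun x =>
  if i ≤ x ∧ x ≤ i + k - 1 then
    τ (x - i + 1) + σ i - 1
  else
    (fun v => if v ≤ σ i then v else v + k - 1)
      (σ (if x < i then x else x - k + 1))

theorem insertPerm_of_lt {k i x : ℕ} (σ τ : ℕ → ℕ) (h : x < i) :
    insertPerm k i σ τ x = if σ x ≤ σ i then σ x else σ x + k - 1 := by
  simp only [insertPerm]
  rw [if_neg (by omega), if_pos h]

theorem insertPerm_block {k i y : ℕ} (σ τ : ℕ → ℕ) (h1 : 1 ≤ y) (h2 : y ≤ k) :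
    insertPerm k i σ τ (i + y - 1) = τ y + σ i - 1 := by
  simp only [insertPerm]
  rw [if_pos (by omega), show i + y - 1 - i + 1 = y by omega]

theorem insertPerm_of_gt {k i y : ℕ} (σ τ : ℕ → ℕ) (hk : 1 ≤ k) (h : i < y) :
    insertPerm k i σ τ (y + k - 1) = if σ y ≤ σ i then σ y else σ y + k - 1 := by
  simp only [insertPerm]
  rw [if_neg (by omega), if_neg (show ¬ y + k - 1 < i by omega), show y + k - 1 - k + 1 = y by omega]

/-- Parallel composition axiom for insertion of permutations: for `i < j`,
`(λ ∘ⱼ μ) ∘ᵢ ν = (λ ∘ᵢ ν) ∘_{j+k-1} μ` as permutations of `{1,…,m+n+k-2}`. -/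
theorem statement3 (m n k i j : ℕ) (hm : 1 ≤ m) (hn : 1 ≤ n) (hk : 1 ≤ k)
    (hi1 : 1 ≤ i) (hij : i < j) (hjm : j ≤ m)
    (lam μ ν : ℕ → ℕ)
    (hlam : Set.BijOn lam (Set.Icc 1 m) (Set.Icc 1 m))
    (hμ : Set.BijOn μ (Set.Icc 1 n) (Set.Icc 1 n))
    (hν : Set.BijOn ν (Set.Icc 1 k) (Set.Icc 1 k)) :
    ∀ x ∈ Set.Icc 1 (m + n + k - 2),
      insertPerm k i (insertPerm n j lam μ) ν x =
        insertPerm n (j + k - 1) (insertPerm k i lam ν) μ x := by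
  intro x ⟨hx1, hx⟩
  have hi := hlam.mapsTo (show i ∈ Set.Icc 1 m from ⟨hi1, by omega⟩)
  have hj := hlam.mapsTo (show j ∈ Set.Icc 1 m from ⟨by omega, hjm⟩)
  have hne : ∀ y z, 1 ≤ y → y ≤ m → 1 ≤ z → z ≤ m → y ≠ z → lam y ≠ lam z :=
    fun y z h1 h2 h3 h4 h e => h (hlam.injOn ⟨h1, h2⟩ ⟨h3, h4⟩ e)
  have hab := hne i j hi1 (by omega) (by omega) hjm (by omega)
  simp only [Set.mem_Icc] at hi hj
  have hAi := insertPerm_of_lt (k := n) lam μ hij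
  have hBj := insertPerm_of_gt lam ν hk hij
  rcases lt_or_ge x i with h | h
  · have hxi := hne x i hx1 (by omega) hi1 (by omega) (by omega)
    have hxj := hne x j hx1 (by omega) (by omega) hjm (by omega)
    rw [insertPerm_of_lt _ _ h, insertPerm_of_lt _ _ (show x < j + k - 1 by omega), hAi, hBj,
      insertPerm_of_lt _ _ h, insertPerm_of_lt _ _ (h.trans hij)]
    split_ifs <;> omega
  rcases lt_or_ge x (i + k) with h' | h'
  · obtain ⟨y, rfl⟩ : ∃ y, x = i + y - 1 := ⟨x - i + 1, by omega⟩
    have hy := hν.mapsTo (show y ∈ Set.Icc 1 k from ⟨by omega, by omega⟩)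
    simp only [Set.mem_Icc] at hy
    rw [insertPerm_of_lt _ _ (show i + y - 1 < j + k - 1 by omega), hBj,
      insertPerm_block _ _ (by omega) (by omega), insertPerm_block _ _ (by omega) (by omega), hAi]
    split_ifs <;> omega
  obtain ⟨y, rfl⟩ : ∃ y, x = y + k - 1 := ⟨x - k + 1, by omega⟩
  have hiy : i < y := by omega
  rw [insertPerm_of_gt _ _ hk hiy, hAi]
  rcases lt_or_ge y j with hyj | hyj
  · have hyi := hne y i (by omega) (by omega) hi1 (by omega) (by omega)
    have hyj' := hne y j (by omega) (by omega) (by omega) hjm (by omega)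
    rw [insertPerm_of_lt _ _ hyj, insertPerm_of_lt _ _ (show y + k - 1 < j + k - 1 by omega), hBj,
      insertPerm_of_gt _ _ hk hiy]
    split_ifs <;> omega
  rcases lt_or_ge y (j + n) with hyn | hyn
  · obtain ⟨z, rfl⟩ : ∃ z, y = j + z - 1 := ⟨y - j + 1, by omega⟩
    have hz := hμ.mapsTo (show z ∈ Set.Icc 1 n from ⟨by omega, by omega⟩)
    simp only [Set.mem_Icc] at hz
    rw [show j + z - 1 + k - 1 = j + k - 1 + z - 1 by omega,
      insertPerm_block _ _ (by omega) (by omega), insertPerm_block _ _ (by omega) (by omega), hBj]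
    split_ifs <;> omega
  · obtain ⟨z, rfl⟩ : ∃ z, y = z + n - 1 := ⟨y - n + 1, by omega⟩
    have hzi := hne z i (by omega) (by omega) hi1 (by omega) (by omega)
    have hzj := hne z j (by omega) (by omega) (by omega) hjm (by omega)
    rw [show z + n - 1 + k - 1 = z + k - 1 + n - 1 by omega,
      insertPerm_of_gt _ _ hn (show j < z by omega),
      insertPerm_of_gt _ _ hn (show j + k - 1 < z + k - 1 by omega), hBj,
      insertPerm_of_gt _ _ hk (show i < z by omega)]
    split_ifs <;> omega
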